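/- arXiv:1712.04725 — 2 statements merged into one kernel-verified Lean document; each statement's English description precedes it below -/
import Mathlib

section
/- Simultaneous collapse for idealistic chains. Let R be a commutative ring, ℓ ≥ 0, ((J₀,U₀),…,(J_ℓ,U_ℓ)) an idealistic chain in R, x ∈ R, and i ∈ {0,…,ℓ}. If the idealistic chain obtained by replacing J_i with J_i ∪ {x} collapses, and the idealistic chain obtained by replacing U_i with U_i ∪ {x} collapses, then the idealistic chain ((J₀,U₀),…,(J_ℓ,U_ℓ)) itself collapses. -/
/-- An idealistic chain `((J 0, U 0), …, (J ℓ, U ℓ))` collapses: there are `u i` in the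
submonoid generated by `U i` and `j i` in the ideal generated by `J i` with
`u 0 * (u 1 * (⋯ (u ℓ + j ℓ) + ⋯) + j 1) + j 0 = 0`, written in expanded form as
`∏ i, u i + ∑ i, (∏ k < i, u k) * j i = 0`. -/
def ChainCollapses {R : Type*} [CommRing R] {ℓ : ℕ}
    (J U : Fin (ℓ + 1) → Set R) : Prop :=
  ∃ u j : Fin (ℓ + 1) → R,
    (∀ i, u i ∈ Submonoid.closure (U i)) ∧
    (∀ i, j i ∈ Ideal.span (J i)) ∧
    (∏ i, u i) + ∑ i, (∏ k ∈ Finset.Iio i, u k) * j i = 0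


/-- Saturation of `I` by `S`. -/
def satI {R : Type*} [CommRing R] (I : Ideal R) (S : Submonoid R) : Ideal R where
  carrier := {y | ∃ u ∈ S, u * y ∈ I}
  zero_mem' := ⟨1, S.one_mem, by simp⟩
  add_mem' := by
    rintro a b ⟨u, hu, ha⟩ ⟨v, hv, hb⟩
    refine ⟨u * v, S.mul_mem hu hv, ?_⟩
    have : u * v * (a + b) = v * (u * a) + u * (v * b) := by ring
    rw [this]
    exact I.add_mem (I.mul_mem_left _ ha) (I.mul_mem_left _ hb)
  smul_mem' := by
    rintro c a ⟨u, hu, ha⟩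
    refine ⟨u, hu, ?_⟩
    have : u * (c • a) = c * (u * a) := by simp only [smul_eq_mul]; ring
    rw [this]
    exact I.mul_mem_left _ ha

theorem mem_satI {R : Type*} [CommRing R] (I : Ideal R) (S : Submonoid R) (y : R) :
    y ∈ satI I S ↔ ∃ u ∈ S, u * y ∈ I := Iff.rfl

/-- The ideal of those `y` that may be placed at the innermost spot. -/
def chI {R : Type*} [CommRing R] : (n : ℕ) → (J U : Fin n → Set R) → Ideal R
  | 0, _, _ => ⊥
  | n + 1, J, U =>
    satI (chI n (fun k => J k.castSucc) (fun k => U k.castSucc) ⊔ Ideal.span (J (Fin.last n)))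
      (Submonoid.closure (U (Fin.last n)))

theorem mem_chI {R : Type*} [CommRing R] (n : ℕ) : ∀ (J U : Fin n → Set R) (y : R),
    y ∈ chI n J U ↔ ∃ u j : Fin n → R,
      (∀ i, u i ∈ Submonoid.closure (U i)) ∧ (∀ i, j i ∈ Ideal.span (J i)) ∧
      (∏ i, u i) * y + ∑ i, (∏ k ∈ Finset.Iio i, u k) * j i = 0 := by
  induction n with
  | zero => intro J U y; simp [chI]
  | succ n ih =>
    intro J U y
    rw [chI, mem_satI]
    constructor
    · rintro ⟨v, hv, h⟩
      obtain ⟨a, ha, b, hb, hab⟩ := Submodule.mem_sup.1 h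
      obtain ⟨u, j, hu, hj, e⟩ := (ih _ _ _).1 ha
      refine ⟨Fin.snoc u v, Fin.snoc j (-b), ?_, ?_, ?_⟩
      · intro i
        induction i using Fin.lastCases with
        | last => simpa using hv
        | cast i => simpa using hu i
      · intro i
        induction i using Fin.lastCases with
        | last => simpa using hb
        | cast i => simpa using hj i
      · rw [Fin.prod_univ_castSucc, Fin.sum_univ_castSucc]
        simp only [Fin.Iio_castSucc, Fin.Iio_last_eq_map, Finset.prod_map, Fin.coe_castSuccEmb,
          Fin.snoc_castSucc, Fin.snoc_last]
        linear_combination e - (∏ i, u i) * hab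
    · rintro ⟨u, j, hu, hj, e⟩
      refine ⟨u (Fin.last n), hu _, ?_⟩
      have : u (Fin.last n) * y = (u (Fin.last n) * y + j (Fin.last n)) + -j (Fin.last n) := by
        ring
      rw [this]
      refine Submodule.add_mem_sup ((ih _ _ _).2 ?_) (neg_mem (hj _))
      refine ⟨fun k => u k.castSucc, fun k => j k.castSucc, fun k => hu _, fun k => hj _, ?_⟩
      rw [Fin.prod_univ_castSucc, Fin.sum_univ_castSucc] at e
      simp only [Fin.Iio_castSucc, Fin.Iio_last_eq_map, Finset.prod_map,
        Fin.coe_castSuccEmb] at e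
      linear_combination e

theorem chI_key {R : Type*} [CommRing R] (x : R) (n : ℕ) :
    ∀ (J U J' U' : Fin n → Set R) (i : Fin n),
    (∀ k, k ≠ i → J' k = J k) → (∀ k, k ≠ i → U' k = U k) →
    J' i = J i ∪ {x} → U' i = U i ∪ {x} →
    ∀ y ∈ chI n J' U, ∀ z ∈ chI n J U', ∃ m : ℕ, y ^ m * z ∈ chI n J U := by
  induction n with
  | zero => intro J U J' U' i; exact i.elim0
  | succ n ih =>
    intro J U J' U' i hJ hU hJi hUi y hy z hz
    rw [chI, mem_satI] at hy hz
    obtain ⟨u, hu, h⟩ := hy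
    obtain ⟨v, hv, h'⟩ := hz
    simp only [chI, mem_satI]
    induction i using Fin.lastCases with
    | last =>
      have e1 : (fun k : Fin n => J' k.castSucc) = fun k => J k.castSucc :=
        funext fun k => hJ _ (Fin.castSucc_lt_last k).ne
      have e2 : (fun k : Fin n => U' k.castSucc) = fun k => U k.castSucc :=
        funext fun k => hU _ (Fin.castSucc_lt_last k).ne
      rw [e1, hJi, Ideal.span_union, ← sup_assoc] at h
      rw [e2] at h'
      rw [hUi, Submonoid.closure_union] at hv
      obtain ⟨w, hw, t, ht, rfl⟩ := Submonoid.mem_sup.1 hv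
      obtain ⟨m, rfl⟩ := Submonoid.mem_closure_singleton.1 ht
      obtain ⟨b, hb, c, hc, hbc⟩ := Submodule.mem_sup.1 h
      obtain ⟨a, rfl⟩ := Ideal.mem_span_singleton'.1 hc
      generalize chI n (fun k => J k.castSucc) (fun k => U k.castSucc) ⊔
        Ideal.span (J (Fin.last n)) = I at *
      refine ⟨m, u ^ m * w, mul_mem (pow_mem hu m) hw, ?_⟩
      have hd : (u * y) ^ m - (a * x) ^ m ∈ I := by
        refine I.mem_of_dvd (sub_dvd_pow_sub_pow _ _ m) ?_
        rw [← hbc]; simpa using hb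
      have : u ^ m * w * (y ^ m * z) =
        (w * z) * ((u * y) ^ m - (a * x) ^ m) + a ^ m * (w * x ^ m * z) := by ring
      rw [this]
      exact I.add_mem (I.mul_mem_left _ hd) (I.mul_mem_left _ h')
    | cast i =>
      rw [hJ _ (Fin.castSucc_lt_last i).ne'] at h
      rw [hU _ (Fin.castSucc_lt_last i).ne'] at hv
      obtain ⟨b, hb, c, hc, hbc⟩ := Submodule.mem_sup.1 h
      obtain ⟨b', hb', c', hc', hbc'⟩ := Submodule.mem_sup.1 h'
      obtain ⟨m, hm⟩ := ih (fun k => J k.castSucc) (fun k => U k.castSucc)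
        (fun k => J' k.castSucc) (fun k => U' k.castSucc) i
        (fun k hk => hJ _ (by simpa using hk)) (fun k hk => hU _ (by simpa using hk))
        hJi hUi b hb b' hb'
      refine ⟨m, u ^ m * v, mul_mem (pow_mem hu m) hv, ?_⟩
      have hd : (u * y) ^ m - b ^ m ∈ Ideal.span (J (Fin.last n)) := by
        refine Ideal.mem_of_dvd _ (sub_dvd_pow_sub_pow _ _ m) ?_
        rw [← hbc]; simpa using hc
      have : u ^ m * v * (y ^ m * z) =
        b ^ m * b' + (b ^ m * c' + (v * z) * ((u * y) ^ m - b ^ m)) := by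
        linear_combination (-b ^ m) * hbc'
      rw [this]
      exact Submodule.add_mem_sup hm
        (Ideal.add_mem _ (Ideal.mul_mem_left _ _ hc') (Ideal.mul_mem_left _ _ hd))

theorem collapses_iff {R : Type*} [CommRing R] {ℓ : ℕ} (J U : Fin (ℓ + 1) → Set R) :
    ChainCollapses J U ↔ 1 ∈ chI (ℓ + 1) J U := by
  rw [mem_chI]; simp only [ChainCollapses, mul_one]

theorem stmt_1 {R : Type*} [CommRing R] {ℓ : ℕ}
    (J U : Fin (ℓ + 1) → Set R) (x : R) (i : Fin (ℓ + 1))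
    (h1 : ChainCollapses (Function.update J i (J i ∪ {x})) U)
    (h2 : ChainCollapses J (Function.update U i (U i ∪ {x}))) :
    ChainCollapses J U := by
  rw [collapses_iff] at *
  obtain ⟨m, hm⟩ := chI_key x (ℓ + 1) J U _ _ i
    (fun k hk => Function.update_of_ne hk _ _) (fun k hk => Function.update_of_ne hk _ _)
    (Function.update_self _ _ _) (Function.update_self _ _ _) 1 h1 1 h2
  simpa using hm
end

section
/- Krull dimension bounds for polynomial rings over an arbitrary commutative ring. Let R be a commutative ring and n ≥ 1, r ≥ 0 integers. (i) If the Krull dimension of R is ≤ r, then the Krull dimension of the polynomial ring R[X₁,…,X_n] is ≤ r + n + r·n. (ii) If the Krull dimension of R[X₁,…,X_n] is ≤ r + n, then the Krull dimension of R is ≤ r. -/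
theorem stmt_19 {R : Type*} [CommRing R] (n r : ℕ) (hn : 1 ≤ n) :
    (ringKrullDim R ≤ (r : WithBot ℕ∞) →
      ringKrullDim (MvPolynomial (Fin n) R) ≤ ((r + n + r * n : ℕ) : WithBot ℕ∞)) ∧
    (ringKrullDim (MvPolynomial (Fin n) R) ≤ ((r + n : ℕ) : WithBot ℕ∞) →
      ringKrullDim R ≤ (r : WithBot ℕ∞)) := by
  constructor
  · intro h
    have key : ringKrullDim (MvPolynomial (Fin n) R) ≤
        (((n : ℕ∞) : WithBot ℕ∞) + 1) * ringKrullDim R + ((n : ℕ∞) : WithBot ℕ∞) := by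
      rw [ringKrullDim, ringKrullDim]
      apply Order.krullDim_le_of_krullDim_preimage_le'
        (PrimeSpectrum.comap (algebraMap R (MvPolynomial (Fin n) R))) ?_ (fun p ↦ ?_)
      · exact fun {a b} h ↦ Ideal.comap_mono h
      · rw [Order.krullDim_eq_of_orderIso
          (PrimeSpectrum.preimageOrderIsoFiber R (MvPolynomial (Fin n) R) p), ← ringKrullDim,
          ringKrullDim_eq_of_ringEquiv (MvPolynomial.algebraTensorAlgEquiv (σ := Fin n) R
            (p.asIdeal.ResidueField)).toRingEquiv,
          MvPolynomial.ringKrullDim_of_isNoetherianRing, ringKrullDim_eq_zero_of_field]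
        simp
    refine key.trans ?_
    have h2 : (((n : ℕ∞) : WithBot ℕ∞) + 1) * ringKrullDim R ≤
        (((n : ℕ∞) : WithBot ℕ∞) + 1) * (r : WithBot ℕ∞) := by
      gcongr
      exact_mod_cast (zero_le : (0 : ℕ∞) ≤ (n + 1 : ℕ∞))
    refine (add_le_add_left h2 _).trans (le_of_eq ?_)
    have : r + n + r * n = (n + 1) * r + n := by ring
    rw [this]
    push_cast
    rfl
  · intro h
    have h1 := (ringKrullDim_add_natCard_le_ringKrullDim_mvPolynomial (R := R) (Fin n)).trans h
    rw [Nat.card_fin] at h1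
    generalize ringKrullDim R = d at h1
    cases d with
    | bot => exact bot_le
    | coe d =>
      cases d with
      | top =>
        exfalso
        have h3 : (⊤ : ℕ∞) + (n : ℕ∞) ≤ ((r + n : ℕ) : ℕ∞) := by exact_mod_cast h1
        rw [top_add, top_le_iff] at h3
        exact ENat.natCast_ne_top _ h3
      | coe d =>
        have h3 : d + n ≤ r + n := by exact_mod_cast h1
        have : d ≤ r := by omega
        exact_mod_cast this
end
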